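/- Let E be a finite-dimensional spectral COSEA and let a be a minimal sharp element of the center E'. Then F={a∘b : b∈E} is closed under ∘ and carries a COSEA structure with zero 0, unit a, orthosupplement a∘b↦a∘b', sum (a∘b_1)⊕_1(a∘b_2)=a∘(b_1⊕b_2) when b_1⊥b_2, scalar action λ(a∘b)=a∘(λb), and product (a∘b)∘(a∘c)=a∘(b∘c); moreover F is a factor: every element of F commuting (under ∘) with all elements of F has the form λa for some λ∈[0,1]. -/

import Mathlib

set_option linter.unusedVariables false

universe u v

theorem prod_eq' {α β : Type*} {p q : α × β} (h1 : p.1 = q.1) (h2 : p.2 = q.2) : p = q :=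
  Prod.ext_iff.mpr ⟨h1, h2⟩

/-- A convex sequential effect algebra (COSEA).  The partial sum `⊕` is modelled by a
total operation `oplus` together with a definedness predicate `perp`; all axioms only
constrain `oplus` on pairs satisfying `perp`.  The scalar action is modelled by a total
map `smul : ℝ → E → E`, with axioms imposed for scalars in `[0,1]`. -/
structure COSEA (E : Type u) where
  zero : E
  one : E
  perp : E → E → Prop
  oplus : E → E → E
  compl : E → E
  smul : ℝ → E → E
  seq : E → E → E
  -- effect algebra axioms
  perp_comm : ∀ a b, perp a b → perp b a
  oplus_comm : ∀ a b, perp a b → oplus a b = oplus b a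
  perp_assoc_right : ∀ a b c, perp a b → perp (oplus a b) c → perp b c
  perp_assoc_left : ∀ a b c, perp a b → perp (oplus a b) c → perp a (oplus b c)
  oplus_assoc : ∀ a b c, perp a b → perp (oplus a b) c →
    oplus a (oplus b c) = oplus (oplus a b) c
  perp_compl : ∀ a, perp a (compl a)
  oplus_compl : ∀ a, oplus a (compl a) = one
  compl_unique : ∀ a b, perp a b → oplus a b = one → b = compl a
  perp_one : ∀ a, perp a one → a = zero
  -- convexity axioms
  smul_smul : ∀ α β a, 0 ≤ α → α ≤ 1 → 0 ≤ β → β ≤ 1 →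
    smul α (smul β a) = smul (α * β) a
  perp_smul_self : ∀ α β a, 0 ≤ α → 0 ≤ β → α + β ≤ 1 → perp (smul α a) (smul β a)
  add_smul : ∀ α β a, 0 ≤ α → 0 ≤ β → α + β ≤ 1 →
    smul (α + β) a = oplus (smul α a) (smul β a)
  perp_smul : ∀ lam a b, 0 ≤ lam → lam ≤ 1 → perp a b → perp (smul lam a) (smul lam b)
  smul_oplus : ∀ lam a b, 0 ≤ lam → lam ≤ 1 → perp a b →
    smul lam (oplus a b) = oplus (smul lam a) (smul lam b)
  one_smul : ∀ a, smul 1 a = a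
  -- sequential product axioms
  seq_perp : ∀ a b c, perp b c → perp (seq a b) (seq a c)
  seq_oplus : ∀ a b c, perp b c → seq a (oplus b c) = oplus (seq a b) (seq a c)
  one_seq : ∀ a, seq one a = a
  seq_eq_zero_comm : ∀ a b, seq a b = zero → seq b a = seq a b
  comm_compl : ∀ a b, seq a b = seq b a → seq a (compl b) = seq (compl b) a
  comm_assoc : ∀ a b c, seq a b = seq b a → seq a (seq b c) = seq (seq a b) c
  comm_seq : ∀ a b c, seq c a = seq a c → seq c b = seq b c →
    seq c (seq a b) = seq (seq a b) c
  comm_oplus : ∀ a b c, seq c a = seq a c → seq c b = seq b c → perp a b →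
    seq c (oplus a b) = seq (oplus a b) c
  smul_seq : ∀ lam a b, 0 ≤ lam → lam ≤ 1 → seq (smul lam a) b = smul lam (seq a b)
  seq_smul : ∀ lam a b, 0 ≤ lam → lam ≤ 1 → seq a (smul lam b) = smul lam (seq a b)

/-- `SumList C l s` : the orthogonal sum of the list `l` is defined and equals `s`. -/
inductive COSEA.SumList {E : Type u} (C : COSEA E) : List E → E → Prop
  | nil : COSEA.SumList C [] C.zero
  | cons {a : E} {l : List E} {s : E} :
      COSEA.SumList C l s → C.perp a s → COSEA.SumList C (a :: l) (C.oplus a s)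

namespace COSEA

variable {E : Type u}

/-- `a ≤ b` in the effect-algebra order. -/
def le (C : COSEA E) (a b : E) : Prop := ∃ c, C.perp a c ∧ C.oplus a c = b

/-- `a` is sharp: the greatest lower bound of `a` and `a'` is `0`,
i.e. every common lower bound of `a` and `a'` lies below `0`. -/
def IsSharp (C : COSEA E) (a : E) : Prop :=
  ∀ c, C.le c a → C.le c (C.compl a) → C.le c C.zero

/-- `a` is a one-dimensional (atomic) sharp element. -/
def IsOneDim (C : COSEA E) (a : E) : Prop :=
  C.IsSharp a ∧ a ≠ C.zero ∧
    ∀ b, C.le b a → ∃ lam : ℝ, 0 ≤ lam ∧ lam ≤ 1 ∧ b = C.smul lam a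

/-- A state on a COSEA. -/
def IsState (C : COSEA E) (ω : E → ℝ) : Prop :=
  (∀ a, 0 ≤ ω a ∧ ω a ≤ 1) ∧ ω C.one = 1 ∧
    ∀ a b, C.perp a b → ω (C.oplus a b) = ω a + ω b

/-- A context presented as an injective finite enumeration of one-dimensional
elements summing to `1`. -/
def IsContextFun (C : COSEA E) {n : ℕ} (a : Fin n → E) : Prop :=
  Function.Injective a ∧ (∀ i, C.IsOneDim (a i)) ∧ C.SumList (List.ofFn a) C.one

/-- A context as a set of effects. -/
def IsContext (C : COSEA E) (A : Set E) : Prop :=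
  ∃ (n : ℕ) (a : Fin n → E), C.IsContextFun a ∧ Set.range a = A

/-- `E` is finite-dimensional: there is no infinite sequence of one-dimensional
elements all of whose initial partial orthogonal sums are defined. -/
def FinDim (C : COSEA E) : Prop :=
  ¬ ∃ f : ℕ → E, (∀ i, C.IsOneDim (f i)) ∧
      ∀ n : ℕ, ∃ s, C.SumList ((List.range n).map f) s

/-- `E` is state-unique. -/
def StateUnique (C : COSEA E) : Prop :=
  ∀ a, C.IsOneDim a → ∃! ω : E → ℝ, C.IsState ω ∧ ω a = 1

/-- `E` is symmetric : `â(b) = b̂(a)` for all one-dimensional `a, b`. -/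
def Symm (C : COSEA E) : Prop :=
  ∀ a b ω ρ, C.IsOneDim a → C.IsOneDim b → C.IsState ω → C.IsState ρ →
    ω a = 1 → ρ b = 1 → ω b = ρ a

/-- `b = λ₁ a₁ ⊕ ⋯ ⊕ λₙ aₙ` with all `λ i ∈ [0,1]`. -/
def SpanRep (C : COSEA E) {n : ℕ} (a : Fin n → E) (lam : Fin n → ℝ) (b : E) : Prop :=
  (∀ i, 0 ≤ lam i ∧ lam i ≤ 1) ∧
    C.SumList (List.ofFn fun i => C.smul (lam i) (a i)) b

/-- `b ∈ E(A)` : `b` has a representation over the context `A`. -/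
def InSpan (C : COSEA E) (A : Set E) (b : E) : Prop :=
  ∃ (n : ℕ) (a : Fin n → E) (lam : Fin n → ℝ),
    C.IsContextFun a ∧ Set.range a = A ∧ C.SpanRep a lam b

/-- `E` is spectral. -/
def Spectral (C : COSEA E) : Prop :=
  C.StateUnique ∧ ∀ b, ∃ A, C.IsContext A ∧ C.InSpan A b

/-- The commutant of a subset. -/
def commutant (C : COSEA E) (F : Set E) : Set E :=
  {b | ∀ a ∈ F, C.seq b a = C.seq a b}

/-- The center `E' = {b : b ∘ a = a ∘ b for all a}`. -/
def center (C : COSEA E) : Set E := C.commutant Set.univ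

/-- `E` is a factor: the center consists of the effects `λ 1`, `λ ∈ [0,1]`. -/
def IsFactor (C : COSEA E) : Prop :=
  C.center = {b | ∃ lam : ℝ, 0 ≤ lam ∧ lam ≤ 1 ∧ b = C.smul lam C.one}

/-- Sub-COSEA. -/
def IsSubCOSEA (C : COSEA E) (F : Set E) : Prop :=
  C.zero ∈ F ∧ C.one ∈ F ∧ (∀ a ∈ F, C.compl a ∈ F) ∧
    (∀ lam : ℝ, 0 ≤ lam → lam ≤ 1 → ∀ a ∈ F, C.smul lam a ∈ F) ∧
    (∀ a ∈ F, ∀ b ∈ F, C.perp a b → C.oplus a b ∈ F) ∧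
    (∀ a ∈ F, ∀ b ∈ F, C.seq a b ∈ F)

/-- `a` is a minimal sharp element of `F`. -/
def MinSharp (C : COSEA E) (F : Set E) (a : E) : Prop :=
  a ∈ F ∧ C.IsSharp a ∧ a ≠ C.zero ∧
    ∀ b ∈ F, C.IsSharp b → b ≠ C.zero → C.le b a → b = a

/-- COSEA isomorphism. -/
def IsIso {F : Type u} (C : COSEA E) (D : COSEA F) (φ : E → F) : Prop :=
  Function.Bijective φ ∧ φ C.one = D.one ∧
    (∀ a b, C.perp a b ↔ D.perp (φ a) (φ b)) ∧
    (∀ a b, C.perp a b → φ (C.oplus a b) = D.oplus (φ a) (φ b)) ∧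
    (∀ lam : ℝ, 0 ≤ lam → lam ≤ 1 → ∀ a, φ (C.smul lam a) = D.smul lam (φ a)) ∧
    (∀ a b, φ (C.seq a b) = D.seq (φ a) (φ b))

/-- `lam` is an eigenvalue of `b` : `lam = â(b)` for some eigeneffect `a` of `b`. -/
def IsEigenvalue (C : COSEA E) (b : E) (lam : ℝ) : Prop :=
  ∃ (a : E) (ω : E → ℝ), C.IsOneDim a ∧ C.seq a b = C.seq b a ∧
    C.IsState ω ∧ ω a = 1 ∧ lam = ω b

/-- The spectrum of `b`. -/
def spectrum (C : COSEA E) (b : E) : Set ℝ := {lam | C.IsEigenvalue b lam}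

/-- `c = ⌈a⌉` : `c` is the least sharp element dominating `a`. -/
def IsCeil (C : COSEA E) (a c : E) : Prop :=
  C.IsSharp c ∧ C.le a c ∧ ∀ d, C.IsSharp d → C.le a d → C.le c d

/-- `b` is a pseudo-inverse of `a` with scalar `lam` :
`⌈b⌉ = ⌈a⌉`, `‖b‖ = 1` and `a ∘ b = b ∘ a = lam ⌈a⌉`. -/
def IsPseudoInvWith (C : COSEA E) (a b : E) (lam : ℝ) : Prop :=
  (∃ ca, C.IsCeil a ca ∧ C.IsCeil b ca ∧
    C.seq a b = C.smul lam ca ∧ C.seq b a = C.smul lam ca) ∧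
  IsGreatest (C.spectrum b) 1 ∧ 0 ≤ lam ∧ lam ≤ 1

/-- The conditional probability map `γ_a` (zero functionals are sent to `0`). -/
noncomputable def condProb (C : COSEA E) (a : E) (ω : E → ℝ) : E → ℝ :=
  fun c => if ω a = 0 then 0 else ω (C.seq a c) / ω a

/-- Membership in `Ω̂(E) = Ω(E) ∪ {0}`. -/
def InOmegaHat (C : COSEA E) (ω : E → ℝ) : Prop :=
  C.IsState ω ∨ ω = fun _ => 0

/-- Direct sum of two COSEAs, with all operations componentwise. -/
def prod {E F : Type u} (C : COSEA E) (D : COSEA F) : COSEA (E × F) where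
  zero := (C.zero, D.zero)
  one := (C.one, D.one)
  perp a b := C.perp a.1 b.1 ∧ D.perp a.2 b.2
  oplus a b := (C.oplus a.1 b.1, D.oplus a.2 b.2)
  compl a := (C.compl a.1, D.compl a.2)
  smul lam a := (C.smul lam a.1, D.smul lam a.2)
  seq a b := (C.seq a.1 b.1, D.seq a.2 b.2)
  perp_comm := fun a b h => ⟨C.perp_comm _ _ h.1, D.perp_comm _ _ h.2⟩
  oplus_comm := fun a b h => prod_eq' (C.oplus_comm _ _ h.1) (D.oplus_comm _ _ h.2)
  perp_assoc_right := fun a b c h1 h2 =>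
    ⟨C.perp_assoc_right _ _ _ h1.1 h2.1, D.perp_assoc_right _ _ _ h1.2 h2.2⟩
  perp_assoc_left := fun a b c h1 h2 =>
    ⟨C.perp_assoc_left _ _ _ h1.1 h2.1, D.perp_assoc_left _ _ _ h1.2 h2.2⟩
  oplus_assoc := fun a b c h1 h2 =>
    prod_eq' (C.oplus_assoc _ _ _ h1.1 h2.1) (D.oplus_assoc _ _ _ h1.2 h2.2)
  perp_compl := fun a => ⟨C.perp_compl _, D.perp_compl _⟩
  oplus_compl := fun a => prod_eq' (C.oplus_compl _) (D.oplus_compl _)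
  compl_unique := fun a b h he =>
    prod_eq' (C.compl_unique _ _ h.1 (congrArg Prod.fst he))
      (D.compl_unique _ _ h.2 (congrArg Prod.snd he))
  perp_one := fun a h => prod_eq' (C.perp_one _ h.1) (D.perp_one _ h.2)
  smul_smul := fun α β a h1 h2 h3 h4 =>
    prod_eq' (C.smul_smul _ _ _ h1 h2 h3 h4) (D.smul_smul _ _ _ h1 h2 h3 h4)
  perp_smul_self := fun α β a h1 h2 h3 =>
    ⟨C.perp_smul_self _ _ _ h1 h2 h3, D.perp_smul_self _ _ _ h1 h2 h3⟩
  add_smul := fun α β a h1 h2 h3 =>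
    prod_eq' (C.add_smul _ _ _ h1 h2 h3) (D.add_smul _ _ _ h1 h2 h3)
  perp_smul := fun lam a b h1 h2 h =>
    ⟨C.perp_smul _ _ _ h1 h2 h.1, D.perp_smul _ _ _ h1 h2 h.2⟩
  smul_oplus := fun lam a b h1 h2 h =>
    prod_eq' (C.smul_oplus _ _ _ h1 h2 h.1) (D.smul_oplus _ _ _ h1 h2 h.2)
  one_smul := fun a => prod_eq' (C.one_smul _) (D.one_smul _)
  seq_perp := fun a b c h => ⟨C.seq_perp _ _ _ h.1, D.seq_perp _ _ _ h.2⟩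
  seq_oplus := fun a b c h => prod_eq' (C.seq_oplus _ _ _ h.1) (D.seq_oplus _ _ _ h.2)
  one_seq := fun a => prod_eq' (C.one_seq _) (D.one_seq _)
  seq_eq_zero_comm := fun a b h =>
    prod_eq' (C.seq_eq_zero_comm _ _ (congrArg Prod.fst h))
      (D.seq_eq_zero_comm _ _ (congrArg Prod.snd h))
  comm_compl := fun a b h =>
    prod_eq' (C.comm_compl _ _ (congrArg Prod.fst h))
      (D.comm_compl _ _ (congrArg Prod.snd h))
  comm_assoc := fun a b c h =>
    prod_eq' (C.comm_assoc _ _ _ (congrArg Prod.fst h))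
      (D.comm_assoc _ _ _ (congrArg Prod.snd h))
  comm_seq := fun a b c h1 h2 =>
    prod_eq' (C.comm_seq _ _ _ (congrArg Prod.fst h1) (congrArg Prod.fst h2))
      (D.comm_seq _ _ _ (congrArg Prod.snd h1) (congrArg Prod.snd h2))
  comm_oplus := fun a b c h1 h2 hp =>
    prod_eq' (C.comm_oplus _ _ _ (congrArg Prod.fst h1) (congrArg Prod.fst h2) hp.1)
      (D.comm_oplus _ _ _ (congrArg Prod.snd h1) (congrArg Prod.snd h2) hp.2)
  smul_seq := fun lam a b h1 h2 =>
    prod_eq' (C.smul_seq _ _ _ h1 h2) (D.smul_seq _ _ _ h1 h2)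
  seq_smul := fun lam a b h1 h2 =>
    prod_eq' (C.seq_smul _ _ _ h1 h2) (D.seq_smul _ _ _ h1 h2)

/-- Direct sum of a family of COSEAs, with all operations componentwise. -/
def pi {ι : Type v} {E : ι → Type u} (C : ∀ i, COSEA (E i)) : COSEA (∀ i, E i) where
  zero := fun i => (C i).zero
  one := fun i => (C i).one
  perp a b := ∀ i, (C i).perp (a i) (b i)
  oplus a b := fun i => (C i).oplus (a i) (b i)
  compl a := fun i => (C i).compl (a i)
  smul lam a := fun i => (C i).smul lam (a i)
  seq a b := fun i => (C i).seq (a i) (b i)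
  perp_comm := fun a b h i => (C i).perp_comm _ _ (h i)
  oplus_comm := fun a b h => funext fun i => (C i).oplus_comm _ _ (h i)
  perp_assoc_right := fun a b c h1 h2 i => (C i).perp_assoc_right _ _ _ (h1 i) (h2 i)
  perp_assoc_left := fun a b c h1 h2 i => (C i).perp_assoc_left _ _ _ (h1 i) (h2 i)
  oplus_assoc := fun a b c h1 h2 => funext fun i => (C i).oplus_assoc _ _ _ (h1 i) (h2 i)
  perp_compl := fun a i => (C i).perp_compl _
  oplus_compl := fun a => funext fun i => (C i).oplus_compl _
  compl_unique := fun a b h he =>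
    funext fun i => (C i).compl_unique _ _ (h i) (congrFun he i)
  perp_one := fun a h => funext fun i => (C i).perp_one _ (h i)
  smul_smul := fun α β a h1 h2 h3 h4 =>
    funext fun i => (C i).smul_smul _ _ _ h1 h2 h3 h4
  perp_smul_self := fun α β a h1 h2 h3 i => (C i).perp_smul_self _ _ _ h1 h2 h3
  add_smul := fun α β a h1 h2 h3 => funext fun i => (C i).add_smul _ _ _ h1 h2 h3
  perp_smul := fun lam a b h1 h2 h i => (C i).perp_smul _ _ _ h1 h2 (h i)
  smul_oplus := fun lam a b h1 h2 h =>
    funext fun i => (C i).smul_oplus _ _ _ h1 h2 (h i)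
  one_smul := fun a => funext fun i => (C i).one_smul _
  seq_perp := fun a b c h i => (C i).seq_perp _ _ _ (h i)
  seq_oplus := fun a b c h => funext fun i => (C i).seq_oplus _ _ _ (h i)
  one_seq := fun a => funext fun i => (C i).one_seq _
  seq_eq_zero_comm := fun a b h =>
    funext fun i => (C i).seq_eq_zero_comm _ _ (congrFun h i)
  comm_compl := fun a b h => funext fun i => (C i).comm_compl _ _ (congrFun h i)
  comm_assoc := fun a b c h => funext fun i => (C i).comm_assoc _ _ _ (congrFun h i)
  comm_seq := fun a b c h1 h2 =>
    funext fun i => (C i).comm_seq _ _ _ (congrFun h1 i) (congrFun h2 i)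
  comm_oplus := fun a b c h1 h2 hp =>
    funext fun i => (C i).comm_oplus _ _ _ (congrFun h1 i) (congrFun h2 i) (hp i)
  smul_seq := fun lam a b h1 h2 => funext fun i => (C i).smul_seq _ _ _ h1 h2
  seq_smul := fun lam a b h1 h2 => funext fun i => (C i).seq_smul _ _ _ h1 h2

end COSEA

namespace COSEA

variable {E : Type u} (C : COSEA E)

theorem compl_compl (a : E) : C.compl (C.compl a) = a :=
  (C.compl_unique _ _ (C.perp_comm _ _ (C.perp_compl a))
    (by rw [C.oplus_comm _ _ (C.perp_comm _ _ (C.perp_compl a)), C.oplus_compl])).symm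

theorem compl_one : C.compl C.one = C.zero :=
  C.perp_one _ (C.perp_comm _ _ (C.perp_compl _))

theorem compl_zero : C.compl C.zero = C.one := by
  rw [← C.compl_one, C.compl_compl]

theorem eq_compl_of_oplus_eq_one {a b : E} (h : C.perp a b) (he : C.oplus a b = C.one) :
    a = C.compl b :=
  C.compl_unique _ _ (C.perp_comm _ _ h) (by rw [C.oplus_comm _ _ (C.perp_comm _ _ h), he])

theorem perp_zero_and_oplus_zero (a : E) : C.perp a C.zero ∧ C.oplus a C.zero = a := by
  have h1 : C.perp C.one C.zero := C.compl_one ▸ C.perp_compl C.one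
  have h2 : C.oplus C.one C.zero = C.one := by
    conv_lhs => rw [← C.compl_one]
    exact C.oplus_compl _
  have hp : C.perp (C.compl a) a := C.perp_comm _ _ (C.perp_compl a)
  have hs : C.oplus (C.compl a) a = C.one := by rw [C.oplus_comm _ _ hp, C.oplus_compl]
  have hq : C.perp (C.oplus (C.compl a) a) C.zero := by rwa [hs]
  refine ⟨C.perp_assoc_right _ _ _ hp hq, ?_⟩
  have := C.compl_unique _ _ (C.perp_assoc_left _ _ _ hp hq)
    (by rw [C.oplus_assoc _ _ _ hp hq, hs, h2])
  rwa [C.compl_compl] at this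

theorem perp_zero (a : E) : C.perp a C.zero := (C.perp_zero_and_oplus_zero a).1

theorem oplus_zero (a : E) : C.oplus a C.zero = a := (C.perp_zero_and_oplus_zero a).2

theorem zero_perp (a : E) : C.perp C.zero a := C.perp_comm _ _ (C.perp_zero a)

theorem zero_oplus (a : E) : C.oplus C.zero a = a := by
  rw [C.oplus_comm _ _ (C.zero_perp a), C.oplus_zero]

theorem eq_compl_oplus_compl {a b : E} (h : C.perp a b) :
    C.perp a (C.compl (C.oplus a b)) ∧
      b = C.compl (C.oplus a (C.compl (C.oplus a b))) := by
  have h' := C.perp_comm _ _ h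
  have hc := C.oplus_comm _ _ h
  have h2 : C.perp (C.oplus b a) (C.compl (C.oplus a b)) := hc ▸ C.perp_compl _
  exact ⟨C.perp_assoc_right _ _ _ h' h2,
    C.eq_compl_of_oplus_eq_one (C.perp_assoc_left _ _ _ h' h2)
      (by rw [C.oplus_assoc _ _ _ h' h2, ← hc, C.oplus_compl])⟩

theorem oplus_left_cancel {a b c : E} (hb : C.perp a b) (hc : C.perp a c)
    (h : C.oplus a b = C.oplus a c) : b = c := by
  rw [(C.eq_compl_oplus_compl hb).2, (C.eq_compl_oplus_compl hc).2, h]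

theorem eq_zero_of_oplus_eq_left {a b : E} (h : C.perp a b) (he : C.oplus a b = a) :
    b = C.zero :=
  C.oplus_left_cancel h (C.perp_zero a) (by rw [he, C.oplus_zero])

theorem eq_zero_of_le_zero {a : E} (h : C.le a C.zero) : a = C.zero := by
  obtain ⟨b, hp, he⟩ := h
  have hp' := C.perp_comm _ _ hp
  refine C.perp_one _ (C.perp_assoc_right b a _ hp' ?_)
  rw [C.oplus_comm _ _ hp', he]
  exact C.zero_perp _

theorem le_trans {a b c : E} (h1 : C.le a b) (h2 : C.le b c) : C.le a c := by
  obtain ⟨d, hd, rfl⟩ := h1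
  obtain ⟨e, he, rfl⟩ := h2
  exact ⟨_, C.perp_assoc_left _ _ _ hd he, C.oplus_assoc _ _ _ hd he⟩

theorem le_oplus_left {a b : E} (h : C.perp a b) : C.le a (C.oplus a b) := ⟨b, h, rfl⟩

theorem le_oplus_right {a b : E} (h : C.perp a b) : C.le b (C.oplus a b) :=
  ⟨a, C.perp_comm _ _ h, C.oplus_comm _ _ (C.perp_comm _ _ h)⟩

theorem le_compl_of_perp {a b : E} (h : C.perp a b) : C.le a (C.compl b) := by
  have h' := C.perp_comm _ _ h
  obtain ⟨hp, he⟩ := C.eq_compl_oplus_compl h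
  exact ⟨_, hp, by rw [he, C.compl_compl, ← he]⟩

theorem perp_of_le {a b c : E} (h : C.perp a b) (hc : C.le c b) : C.perp a c := by
  obtain ⟨d, hd, rfl⟩ := hc
  have hd' := C.perp_comm _ _ hd
  rw [C.oplus_comm _ _ hd] at h
  exact C.perp_comm _ _ (C.perp_assoc_right _ _ _ hd' (C.perp_comm _ _ h))

theorem seq_zero (a : E) : C.seq a C.zero = C.zero :=
  C.eq_zero_of_oplus_eq_left (C.seq_perp a _ _ (C.perp_zero C.zero))
    (by rw [← C.seq_oplus _ _ _ (C.perp_zero C.zero), C.oplus_zero])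

theorem zero_seq (a : E) : C.seq C.zero a = C.zero := by
  rw [C.seq_eq_zero_comm _ _ (C.seq_zero a), C.seq_zero]

theorem seq_one (a : E) : C.seq a C.one = a := by
  have h := C.comm_compl a C.zero (by rw [C.seq_zero, C.zero_seq])
  rwa [C.compl_zero, C.one_seq] at h

theorem seq_oplus_seq_compl (a b : E) :
    C.perp (C.seq a b) (C.seq a (C.compl b)) ∧
      C.oplus (C.seq a b) (C.seq a (C.compl b)) = a := by
  refine ⟨C.seq_perp _ _ _ (C.perp_compl b), ?_⟩
  rw [← C.seq_oplus _ _ _ (C.perp_compl b), C.oplus_compl, C.seq_one]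

theorem seq_le (a b : E) : C.le (C.seq a b) a := ⟨_, C.seq_oplus_seq_compl a b⟩

theorem seq_mono (a : E) {b c : E} (h : C.le b c) : C.le (C.seq a b) (C.seq a c) := by
  obtain ⟨d, hd, rfl⟩ := h
  exact ⟨_, C.seq_perp _ _ _ hd, (C.seq_oplus _ _ _ hd).symm⟩

theorem seq_eq_zero_of_le {a b c : E} (h : C.le b c) (hc : C.seq a c = C.zero) :
    C.seq a b = C.zero :=
  C.eq_zero_of_le_zero (hc ▸ C.seq_mono a h)

theorem seq_compl_eq_zero {a b : E} (h : C.seq a b = a) : C.seq a (C.compl b) = C.zero := by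
  obtain ⟨hp, he⟩ := C.seq_oplus_seq_compl a b
  rw [h] at hp he
  exact C.eq_zero_of_oplus_eq_left hp he

theorem seq_eq_self_of_compl {a b : E} (h : C.seq a (C.compl b) = C.zero) :
    C.seq a b = a := by
  have he := (C.seq_oplus_seq_compl a b).2
  rwa [h, C.oplus_zero] at he

theorem comm_of_comm_compl {a b : E} (h : C.seq a (C.compl b) = C.seq (C.compl b) a) :
    C.seq a b = C.seq b a := by
  have := C.comm_compl _ _ h
  rwa [C.compl_compl] at this

theorem IsSharp.seq_compl {C : COSEA E} {a : E} (h : C.IsSharp a) :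
    C.seq a (C.compl a) = C.zero := by
  have hc : C.seq a (C.compl a) = C.seq (C.compl a) a := C.comm_compl _ _ rfl
  exact C.eq_zero_of_le_zero (h _ (C.seq_le _ _) (hc ▸ C.seq_le _ _))

theorem IsSharp.seq_self {C : COSEA E} {a : E} (h : C.IsSharp a) : C.seq a a = a :=
  C.seq_eq_self_of_compl h.seq_compl

theorem IsSharp.seq_eq_zero {C : COSEA E} {a b : E} (h : C.IsSharp a) (hp : C.perp a b) :
    C.seq a b = C.zero :=
  C.seq_eq_zero_of_le (C.le_compl_of_perp (C.perp_comm _ _ hp)) h.seq_compl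

theorem mem_center {a : E} : a ∈ C.center ↔ ∀ b, C.seq a b = C.seq b a :=
  ⟨fun h b => h b trivial, fun h b _ => h b⟩

theorem isSharp_of_mem_center {q : E} (hq : ∀ b, C.seq q b = C.seq b q)
    (hs : C.seq q q = q) : C.IsSharp q := by
  intro d h1 h2
  have h0 := C.seq_compl_eq_zero hs
  have e1 : C.seq d q = C.zero := by rw [← hq]; exact C.seq_eq_zero_of_le h2 h0
  have hc : ∀ b, C.seq (C.compl q) b = C.seq b (C.compl q) :=
    fun b => (C.comm_compl _ _ (hq b).symm).symm
  have e2 : C.seq d (C.compl q) = C.zero := by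
    rw [← hc]
    exact C.seq_eq_zero_of_le h1 (by rw [hc, h0])
  have h := C.seq_eq_self_of_compl e2
  rw [← h, e1]
  exact ⟨_, C.perp_zero _, C.oplus_zero _⟩

theorem smul_zero {r : ℝ} (h0 : 0 ≤ r) (h1 : r ≤ 1) : C.smul r C.zero = C.zero :=
  C.eq_zero_of_oplus_eq_left (C.perp_smul r _ _ h0 h1 (C.perp_zero C.zero))
    (by rw [← C.smul_oplus _ _ _ h0 h1 (C.perp_zero C.zero), C.oplus_zero])

theorem zero_smul (y : E) : C.smul 0 y = C.zero := by
  have h := C.perp_smul_self 0 0 y le_rfl le_rfl (by norm_num)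
  refine C.eq_zero_of_oplus_eq_left h ?_
  rw [← C.add_smul 0 0 y le_rfl le_rfl (by norm_num), add_zero]

theorem eq_zero_of_smul_eq_zero {r : ℝ} {y : E} (h0 : 0 < r) (h1 : r ≤ 1)
    (h : C.smul r y = C.zero) : y = C.zero := by
  obtain ⟨n, hn⟩ := exists_nat_one_div_lt h0
  have hn0 : (0 : ℝ) < n + 1 := by positivity
  have hq : C.smul (1 / (n + 1)) y = C.zero := by
    have hle : 1 / ((n : ℝ) + 1) / r ≤ 1 := (div_le_one h0).2 hn.le
    have hnn : 0 ≤ 1 / ((n : ℝ) + 1) / r := by positivity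
    have := C.smul_smul _ r y hnn hle h0.le h1
    rw [h, C.smul_zero hnn hle, div_mul_cancel₀ _ h0.ne'] at this
    exact this.symm
  have hk : ∀ k : ℕ, k ≤ n + 1 → C.smul (k / (n + 1)) y = C.zero := by
    intro k
    induction k with
    | zero => intro _; rw [Nat.cast_zero, zero_div, C.zero_smul]
    | succ k ih =>
      intro hk
      have hle : (k : ℝ) / (n + 1) + 1 / (n + 1) ≤ 1 := by
        rw [← add_div, div_le_one hn0]
        exact_mod_cast hk
      rw [Nat.cast_succ, add_div, C.add_smul _ _ _ (by positivity) (by positivity) hle, hq,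
        C.oplus_zero, ih (by omega)]
  have := hk (n + 1) le_rfl
  rwa [Nat.cast_succ, div_self hn0.ne', C.one_smul] at this

theorem eq_zero_of_smul_eq_smul_of_lt {r s : ℝ} {y : E} (h0 : 0 ≤ r) (h1 : s ≤ 1) (hrs : r < s)
    (h : C.smul r y = C.smul s y) : y = C.zero := by
  have hle : r + (s - r) ≤ 1 := by linarith
  have hd : 0 ≤ s - r := by linarith
  have he := C.add_smul r (s - r) y h0 hd hle
  rw [add_sub_cancel, ← h] at he
  exact C.eq_zero_of_smul_eq_zero (r := s - r) (by linarith) (by linarith)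
    (C.eq_zero_of_oplus_eq_left (C.perp_smul_self _ _ _ h0 hd hle) he.symm)

theorem eq_zero_or_eq_of_smul_eq_smul {r s : ℝ} {y : E} (hr : 0 ≤ r ∧ r ≤ 1)
    (hs : 0 ≤ s ∧ s ≤ 1) (h : C.smul r y = C.smul s y) : y = C.zero ∨ r = s := by
  rcases lt_trichotomy r s with hlt | heq | hgt
  · exact .inl (C.eq_zero_of_smul_eq_smul_of_lt hr.1 hs.2 hlt h)
  · exact .inr heq
  · exact .inl (C.eq_zero_of_smul_eq_smul_of_lt hs.1 hr.2 hgt h.symm)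

namespace SumList

variable {C}

theorem unique {l : List E} {s t : E} (hs : C.SumList l s) (ht : C.SumList l t) : s = t := by
  induction hs generalizing t with
  | nil => cases ht; rfl
  | cons _ _ ih =>
    cases ht with
    | cons h _ => rw [ih h]

theorem map_seq {l : List E} {s : E} (h : C.SumList l s) (b : E) :
    C.SumList (l.map (C.seq b)) (C.seq b s) := by
  induction h with
  | nil => rw [C.seq_zero]; exact .nil
  | cons _ hp ih => rw [C.seq_oplus _ _ _ hp]; exact .cons ih (C.seq_perp _ _ _ hp)

theorem map_smul {l : List E} {s : E} (h : C.SumList l s) {r : ℝ} (h0 : 0 ≤ r) (h1 : r ≤ 1) :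
    C.SumList (l.map (C.smul r)) (C.smul r s) := by
  induction h with
  | nil => rw [C.smul_zero h0 h1]; exact .nil
  | cons _ hp ih =>
    rw [C.smul_oplus _ _ _ h0 h1 hp]; exact .cons ih (C.perp_smul _ _ _ h0 h1 hp)

theorem eq_zero {l : List E} {s : E} (h : C.SumList l s) (hl : ∀ e ∈ l, e = C.zero) :
    s = C.zero := by
  induction h with
  | nil => rfl
  | cons _ _ ih =>
    rw [ih fun e he => hl e (List.mem_cons_of_mem _ he), hl _ List.mem_cons_self, C.oplus_zero]

theorem le_of_mem {l : List E} {s e : E} (h : C.SumList l s) (he : e ∈ l) : C.le e s := by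
  induction h with
  | nil => simp at he
  | cons _ hp ih =>
    rcases List.mem_cons.1 he with rfl | he
    · exact C.le_oplus_left hp
    · exact C.le_trans (ih he) (C.le_oplus_right hp)

theorem pairwise_perp {l : List E} {s : E} (h : C.SumList l s) : l.Pairwise C.perp := by
  induction h with
  | nil => exact .nil
  | cons h hp ih => exact .cons (fun e he => C.perp_of_le hp (h.le_of_mem he)) ih

theorem comm {l : List E} {s c : E} (h : C.SumList l s)
    (hl : ∀ e ∈ l, C.seq c e = C.seq e c) : C.seq c s = C.seq s c := by
  induction h with
  | nil => rw [C.seq_zero, C.zero_seq]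
  | cons _ hp ih =>
    exact C.comm_oplus _ _ _ (hl _ List.mem_cons_self)
      (ih fun e he => hl e (List.mem_cons_of_mem _ he)) hp

theorem eq_single {ι : Type*} {l : List ι} {f : ι → E} {s : E} (h : C.SumList (l.map f) s)
    (hl : l.Nodup) {i : ι} (hi : i ∈ l) (hf : ∀ j, j ≠ i → f j = C.zero) : s = f i := by
  induction l generalizing s with
  | nil => simp at hi
  | cons k t ih =>
    rw [List.nodup_cons] at hl
    rw [List.map_cons] at h
    cases h with
    | cons ht hp =>
      by_cases hk : k = i
      · subst hk
        rw [ht.eq_zero, C.oplus_zero]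
        intro e he
        obtain ⟨j, hj, rfl⟩ := List.mem_map.1 he
        exact hf j fun hjk => hl.1 (hjk ▸ hj)
      · rw [hf k hk, C.zero_oplus]
        exact ih ht hl.2 ((List.mem_cons.1 hi).resolve_left (Ne.symm hk))

theorem exists_filter {ι : Type*} (P : ι → Prop) [DecidablePred P] {l : List ι} {f : ι → E}
    {s : E} (h : C.SumList (l.map f) s) :
    ∃ p q, C.SumList ((l.filter fun i => P i).map f) p ∧
      C.SumList ((l.filter fun i => ¬P i).map f) q ∧ C.perp p q ∧ C.oplus p q = s := by
  induction l generalizing s with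
  | nil =>
    cases h
    exact ⟨_, _, .nil, .nil, C.perp_zero _, C.oplus_zero _⟩
  | cons k t ih =>
    rw [List.map_cons] at h
    cases h with
    | cons ht hp =>
      obtain ⟨p, q, h1, h2, hpq, rfl⟩ := ih ht
      have hkp : C.perp (f k) p := C.perp_of_le hp (C.le_oplus_left hpq)
      have hkq : C.perp (f k) q := C.perp_of_le hp (C.le_oplus_right hpq)
      have hqp := C.perp_comm _ _ hpq
      have hk' := C.perp_comm _ _ hp
      by_cases hk : P k
      · refine ⟨C.oplus (f k) p, q, by simpa [hk] using SumList.cons h1 hkp,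
          by simpa [hk] using h2, ?_, ?_⟩
        · rw [C.oplus_comm _ _ hpq] at hk'
          rw [C.oplus_comm _ _ hkp]
          exact C.perp_comm _ _ (C.perp_assoc_left _ _ _ hqp hk')
        · rw [C.oplus_comm _ _ hpq] at hk' hp ⊢
          have h3 := C.perp_assoc_left _ _ _ hqp hk'
          rw [C.oplus_comm _ _ hp, ← C.oplus_assoc _ _ _ hqp hk',
            C.oplus_comm _ _ hkp, C.oplus_comm _ _ h3]
      · refine ⟨p, C.oplus (f k) q, by simpa [hk] using h1,
          by simpa [hk] using SumList.cons h2 hkq, ?_, ?_⟩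
        · rw [C.oplus_comm _ _ hkq]
          exact C.perp_assoc_left _ _ _ hpq hk'
        · rw [C.oplus_comm _ _ hkq, C.oplus_assoc _ _ _ hpq hk', C.oplus_comm _ _ hp]

end SumList

theorem IsContextFun.seq_eq_zero {C : COSEA E} {n : ℕ} {e : Fin n → E} (he : C.IsContextFun e)
    {i j : Fin n} (hij : i ≠ j) : C.seq (e i) (e j) = C.zero := by
  have h := List.pairwise_ofFn.1 he.2.2.pairwise_perp
  refine (he.2.1 i).1.seq_eq_zero ?_
  rcases lt_or_gt_of_ne hij with hlt | hgt
  · exact h hlt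
  · exact C.perp_comm _ _ (h hgt)

theorem IsContextFun.seq_eq_smul {C : COSEA E} {n : ℕ} {e : Fin n → E} {r : Fin n → ℝ} {x : E}
    (he : C.IsContextFun e) (hx : C.SpanRep e r x) (i : Fin n) :
    C.seq (e i) x = C.smul (r i) (e i) := by
  have h := hx.2.map_seq (e i)
  rw [List.ofFn_eq_map, List.map_map] at h
  rw [h.eq_single (List.nodup_finRange n) (List.mem_finRange i) fun j hj => ?_,
    Function.comp_apply, C.seq_smul _ _ _ (hx.1 i).1 (hx.1 i).2, (he.2.1 i).1.seq_self]
  rw [Function.comp_apply, C.seq_smul _ _ _ (hx.1 j).1 (hx.1 j).2, he.seq_eq_zero hj.symm,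
    C.smul_zero (hx.1 j).1 (hx.1 j).2]

theorem Spectral.mem_center {C : COSEA E} (hC : C.Spectral) {p : E}
    (hp : ∀ c, C.IsOneDim c → C.seq p c = C.seq c p) (b : E) : C.seq p b = C.seq b p := by
  obtain ⟨-, -, n, e, r, he, -, hr, hb⟩ := hC.2 b
  refine hb.comm fun y hy => ?_
  obtain ⟨i, rfl⟩ := List.mem_ofFn.1 hy
  rw [C.seq_smul _ _ _ (hr i).1 (hr i).2, C.smul_seq _ _ _ (hr i).1 (hr i).2,
    hp _ (he.2.1 i)]

/-- A one-dimensional element only meets the eigeneffects of a central element for a single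
eigenvalue. -/
theorem IsOneDim.exists_eigenvalue {C : COSEA E} {c x : E} (hc : C.IsOneDim c)
    (hx : ∀ b, C.seq x b = C.seq b x) {n : ℕ} {e : Fin n → E} {r : Fin n → ℝ}
    (he : C.IsContextFun e) (hr : C.SpanRep e r x) :
    ∃ m : ℝ, ∀ i, C.seq c (e i) = C.zero ∨ r i = m := by
  obtain ⟨m, h0, h1, hm⟩ := hc.2.2 _ (C.seq_le c x)
  refine ⟨m, fun i => ?_⟩
  refine C.eq_zero_or_eq_of_smul_eq_smul (hr.1 i) ⟨h0, h1⟩ ?_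
  rw [← C.smul_seq _ _ _ h0 h1, ← hm, ← C.comm_assoc _ _ _ (hx c).symm, hx,
    he.seq_eq_smul hr, C.seq_smul _ _ _ (hr.1 i).1 (hr.1 i).2]

/-- Eigenprojections of a central element are central and idempotent. -/
theorem Spectral.exists_central_eigenprojection {C : COSEA E} (hC : C.Spectral) {x : E}
    (hx : ∀ b, C.seq x b = C.seq b x) {n : ℕ} {e : Fin n → E} {r : Fin n → ℝ}
    (he : C.IsContextFun e) (hr : C.SpanRep e r x) (i : Fin n) :
    ∃ p, (∀ b, C.seq p b = C.seq b p) ∧ C.seq p p = p ∧ C.le (e i) p ∧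
      C.seq p x = C.smul (r i) p := by
  classical
  have hone := he.2.2
  rw [List.ofFn_eq_map] at hone
  obtain ⟨p, q, hp, hq, hpq, hs⟩ := hone.exists_filter fun j => r j = r i
  have hq' : q = C.compl p := C.compl_unique _ _ hpq hs
  have zero_p : ∀ c, (∀ j, r j = r i → C.seq c (e j) = C.zero) → C.seq c p = C.zero := by
    refine fun c hc => (hp.map_seq c).eq_zero ?_
    simpa using hc
  have zero_q : ∀ c, (∀ j, r j ≠ r i → C.seq c (e j) = C.zero) → C.seq c q = C.zero := by
    refine fun c hc => (hq.map_seq c).eq_zero ?_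
    simpa using hc
  have hcen : ∀ b, C.seq p b = C.seq b p := by
    refine hC.mem_center fun c hc => ?_
    obtain ⟨m, hm⟩ := hc.exists_eigenvalue hx he hr
    by_cases h : r i = m
    · have h0 := zero_q c fun j hj => (hm j).resolve_right fun hj' => hj (hj'.trans h.symm)
      have h1 := C.seq_eq_zero_comm _ _ h0
      rw [hq'] at h1
      exact (C.comm_of_comm_compl h1.symm).symm
    · exact C.seq_eq_zero_comm _ _
        (zero_p c fun j hj => (hm j).resolve_right fun hj' => h (hj.symm.trans hj'))
  refine ⟨p, hcen, ?_, ?_, ?_⟩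
  · refine C.seq_eq_self_of_compl ?_
    rw [← hq']
    refine zero_q p fun j hj => ?_
    rw [hcen]
    exact zero_p _ fun k hk => he.seq_eq_zero fun hjk => hj (hjk ▸ hk)
  · exact hp.le_of_mem (List.mem_map_of_mem (by simp))
  · rw [← hx]
    refine (hp.map_seq x).unique ?_
    have h := hp.map_smul (hr.1 i).1 (hr.1 i).2
    rw [List.map_map] at h ⊢
    convert h using 1
    refine List.map_congr_left fun j hj => ?_
    have hji : r j = r i := by simpa using hj
    rw [Function.comp_apply, Function.comp_apply, hx, he.seq_eq_smul hr, hji]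

/-- A central element below a minimal sharp central element is a multiple of it. -/
theorem MinSharp.eq_smul_of_mem_center {C : COSEA E} (hC : C.Spectral) {a x : E}
    (ha : C.MinSharp C.center a) (hx : ∀ b, C.seq x b = C.seq b x) (hax : C.seq a x = x) :
    ∃ r : ℝ, 0 ≤ r ∧ r ≤ 1 ∧ x = C.smul r a := by
  obtain ⟨hac, has, ha0, hmin⟩ := ha
  rw [C.mem_center] at hac
  obtain ⟨-, -, n, e, r, he, -, hr⟩ := hC.2 x
  obtain ⟨i, hi⟩ : ∃ i, C.seq a (e i) ≠ C.zero := by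
    by_contra! h
    refine ha0 ?_
    rw [← C.seq_one a]
    refine (he.2.2.map_seq a).eq_zero ?_
    simpa [List.mem_ofFn] using h
  obtain ⟨p, hpc, hpp, hep, hpx⟩ := hC.exists_central_eigenprojection hx he hr i
  have hap : ∀ b, C.seq (C.seq a p) b = C.seq b (C.seq a p) := fun b =>
    (C.comm_seq _ _ _ (hac b).symm (hpc b).symm).symm
  have hs : C.seq (C.seq a p) (C.seq a p) = C.seq a p := by
    rw [← C.comm_assoc _ _ _ (hac p), C.comm_assoc p a p (hpc a), hpc a,
      ← C.comm_assoc a p p (hac p), hpp, C.comm_assoc a a p rfl, has.seq_self]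
  have hpa : C.seq a p = a :=
    hmin _ (C.mem_center.2 hap) (C.isSharp_of_mem_center hap hs)
      (fun h0 => hi (C.seq_eq_zero_of_le hep h0)) (C.seq_le _ _)
  refine ⟨r i, (hr.1 i).1, (hr.1 i).2, ?_⟩
  conv_lhs => rw [← hax, ← hpa, ← C.comm_assoc _ _ _ (hac p), hpx,
    C.seq_smul _ _ _ (hr.1 i).1 (hr.1 i).2, hpa]

theorem seq_of_mem_range {a x : E} (has : C.IsSharp a) (hx : x ∈ Set.range (C.seq a)) :
    C.seq a x = x := by
  obtain ⟨b, rfl⟩ := hx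
  rw [C.comm_assoc a a b rfl, has.seq_self]

theorem seq_seq_of_mem_range {a x : E} (hac : ∀ b, C.seq a b = C.seq b a) (has : C.IsSharp a)
    (hx : x ∈ Set.range (C.seq a)) (y : E) : C.seq a (C.seq x y) = C.seq x y := by
  rw [C.comm_assoc a x y (hac x), C.seq_of_mem_range has hx]

theorem seq_seq_seq {a : E} (hac : ∀ b, C.seq a b = C.seq b a) (has : C.IsSharp a) (b c : E) :
    C.seq (C.seq a b) (C.seq a c) = C.seq a (C.seq b c) := by
  rw [← C.comm_assoc _ _ _ (hac b), C.comm_assoc b a c (hac b).symm, ← hac,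
    ← C.comm_assoc a b c (hac b), C.comm_assoc a a _ rfl, has.seq_self]

theorem seq_compl_seq {a : E} (has : C.IsSharp a) (b : E) :
    C.seq a (C.compl (C.seq a b)) = C.seq a (C.compl b) := by
  have h1 := C.seq_oplus_seq_compl a b
  have h2 := C.seq_oplus_seq_compl a (C.seq a b)
  rw [C.seq_of_mem_range has ⟨b, rfl⟩] at h2
  exact C.oplus_left_cancel h2.1 h1.1 (h2.2.trans h1.2.symm)

theorem seq_oplus_of_mem_range {a x y : E} (has : C.IsSharp a) (hx : x ∈ Set.range (C.seq a))
    (hy : y ∈ Set.range (C.seq a)) (h : C.perp x y) : C.seq a (C.oplus x y) = C.oplus x y := by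
  rw [C.seq_oplus _ _ _ h, C.seq_of_mem_range has hx, C.seq_of_mem_range has hy]

theorem seq_smul_of_mem_range {a x : E} (has : C.IsSharp a) (hx : x ∈ Set.range (C.seq a))
    {r : ℝ} (h0 : 0 ≤ r) (h1 : r ≤ 1) : C.seq a (C.smul r x) = C.smul r x := by
  rw [C.seq_smul _ _ _ h0 h1, C.seq_of_mem_range has hx]

/-- The COSEA structure on `{a ∘ b : b ∈ E}` for a central sharp element `a`. -/
def corner {a : E} (hac : ∀ b, C.seq a b = C.seq b a) (has : C.IsSharp a) :
    COSEA {x : E // x ∈ Set.range (C.seq a)} where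
  zero := ⟨C.seq a C.zero, _, rfl⟩
  one := ⟨C.seq a C.one, _, rfl⟩
  perp x y := C.perp x y
  oplus x y := ⟨C.seq a (C.oplus x y), _, rfl⟩
  compl x := ⟨C.seq a (C.compl x), _, rfl⟩
  smul r x := ⟨C.seq a (C.smul r x), _, rfl⟩
  seq x y := ⟨C.seq a (C.seq x y), _, rfl⟩
  perp_comm x y h := C.perp_comm _ _ h
  oplus_comm x y h := Subtype.ext (congrArg (C.seq a) (C.oplus_comm _ _ h))
  perp_assoc_right x y z h h' := by
    change C.perp (C.seq a _) z at h'
    rw [C.seq_oplus_of_mem_range has x.2 y.2 h] at h'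
    exact C.perp_assoc_right _ _ _ h h'
  perp_assoc_left x y z h h' := by
    change C.perp (C.seq a _) z at h'
    rw [C.seq_oplus_of_mem_range has x.2 y.2 h] at h'
    change C.perp x (C.seq a _)
    rw [C.seq_oplus_of_mem_range has y.2 z.2 (C.perp_assoc_right _ _ _ h h')]
    exact C.perp_assoc_left _ _ _ h h'
  oplus_assoc x y z h h' := by
    change C.perp (C.seq a _) z at h'
    rw [C.seq_oplus_of_mem_range has x.2 y.2 h] at h'
    refine Subtype.ext (congrArg (C.seq a) ?_)
    change C.oplus _ (C.seq a _) = C.oplus (C.seq a _) _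
    rw [C.seq_oplus_of_mem_range has y.2 z.2 (C.perp_assoc_right _ _ _ h h'),
      C.seq_oplus_of_mem_range has x.2 y.2 h, C.oplus_assoc _ _ _ h h']
  perp_compl x := by
    have h := (C.seq_oplus_seq_compl a x).1
    rwa [C.seq_of_mem_range has x.2] at h
  oplus_compl x := by
    have h := (C.seq_oplus_seq_compl a x).2
    rw [C.seq_of_mem_range has x.2] at h
    refine Subtype.ext ?_
    change C.seq a (C.oplus x (C.seq a (C.compl x))) = C.seq a C.one
    rw [h, has.seq_self, C.seq_one]
  compl_unique x y h he := by
    have h' := C.seq_oplus_seq_compl a x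
    rw [C.seq_of_mem_range has x.2] at h'
    have he' : C.seq a (C.oplus x y) = C.seq a C.one := congrArg Subtype.val he
    rw [C.seq_oplus_of_mem_range has x.2 y.2 h, C.seq_one] at he'
    exact Subtype.ext (C.oplus_left_cancel h h'.1 (he'.trans h'.2.symm))
  perp_one x h := by
    change C.perp x (C.seq a C.one) at h
    rw [C.seq_one] at h
    refine Subtype.ext ?_
    change (x : E) = C.seq a C.zero
    rw [C.seq_zero, ← C.seq_of_mem_range has x.2]
    exact has.seq_eq_zero (C.perp_comm _ _ h)
  smul_smul r s x h1 h2 h3 h4 := by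
    refine Subtype.ext (congrArg (C.seq a) ?_)
    change C.smul r (C.seq a (C.smul s x)) = _
    rw [C.seq_smul_of_mem_range has x.2 h3 h4, C.smul_smul _ _ _ h1 h2 h3 h4]
  perp_smul_self r s x h1 h2 h3 := C.seq_perp _ _ _ (C.perp_smul_self _ _ _ h1 h2 h3)
  add_smul r s x h1 h2 h3 := by
    refine Subtype.ext (congrArg (C.seq a) ?_)
    change C.smul (r + s) (x : E) = C.oplus (C.seq a _) (C.seq a _)
    rw [C.seq_smul_of_mem_range has x.2 h1 (by linarith),
      C.seq_smul_of_mem_range has x.2 h2 (by linarith), C.add_smul _ _ _ h1 h2 h3]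
  perp_smul r x y h0 h1 h := C.seq_perp _ _ _ (C.perp_smul _ _ _ h0 h1 h)
  smul_oplus r x y h0 h1 h := by
    refine Subtype.ext (congrArg (C.seq a) ?_)
    change C.smul r (C.seq a _) = C.oplus (C.seq a _) (C.seq a _)
    rw [C.seq_smul_of_mem_range has x.2 h0 h1, C.seq_smul_of_mem_range has y.2 h0 h1,
      C.seq_oplus_of_mem_range has x.2 y.2 h, C.smul_oplus _ _ _ h0 h1 h]
  one_smul x := by
    refine Subtype.ext ?_
    change C.seq a (C.smul 1 x) = x
    rw [C.one_smul, C.seq_of_mem_range has x.2]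
  seq_perp x y z h := C.seq_perp _ _ _ (C.seq_perp _ _ _ h)
  seq_oplus x y z h := by
    refine Subtype.ext (congrArg (C.seq a) ?_)
    change C.seq x (C.seq a _) = C.oplus (C.seq a _) (C.seq a _)
    rw [C.seq_oplus_of_mem_range has y.2 z.2 h, C.seq_seq_of_mem_range hac has x.2,
      C.seq_seq_of_mem_range hac has x.2, C.seq_oplus _ _ _ h]
  one_seq x := by
    refine Subtype.ext ?_
    change C.seq a (C.seq (C.seq a C.one) x) = x
    rw [C.seq_one, C.seq_of_mem_range has x.2, C.seq_of_mem_range has x.2]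
  seq_eq_zero_comm x y h := by
    have h' : C.seq a (C.seq x y) = C.seq a C.zero := congrArg Subtype.val h
    rw [C.seq_seq_of_mem_range hac has x.2, C.seq_zero] at h'
    exact Subtype.ext (congrArg (C.seq a) (C.seq_eq_zero_comm _ _ h'))
  comm_compl x y h := by
    have h' : C.seq a (C.seq x y) = C.seq a (C.seq y x) := congrArg Subtype.val h
    rw [C.seq_seq_of_mem_range hac has x.2, C.seq_seq_of_mem_range hac has y.2] at h'
    exact Subtype.ext (congrArg (C.seq a)
      (C.comm_seq _ _ _ (hac x).symm (C.comm_compl _ _ h')))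
  comm_assoc x y z h := by
    have h' : C.seq a (C.seq x y) = C.seq a (C.seq y x) := congrArg Subtype.val h
    rw [C.seq_seq_of_mem_range hac has x.2, C.seq_seq_of_mem_range hac has y.2] at h'
    refine Subtype.ext (congrArg (C.seq a) ?_)
    change C.seq x (C.seq a _) = C.seq (C.seq a _) z
    rw [C.seq_seq_of_mem_range hac has x.2, C.seq_seq_of_mem_range hac has y.2,
      C.comm_assoc _ _ _ h']
  comm_seq x y z h1 h2 := by
    have h1' : C.seq a (C.seq z x) = C.seq a (C.seq x z) := congrArg Subtype.val h1
    have h2' : C.seq a (C.seq z y) = C.seq a (C.seq y z) := congrArg Subtype.val h2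
    rw [C.seq_seq_of_mem_range hac has z.2] at h1' h2'
    rw [C.seq_seq_of_mem_range hac has x.2] at h1'
    rw [C.seq_seq_of_mem_range hac has y.2] at h2'
    exact Subtype.ext (congrArg (C.seq a)
      (C.comm_seq _ _ _ (hac z).symm (C.comm_seq _ _ _ h1' h2')))
  comm_oplus x y z h1 h2 h := by
    have h1' : C.seq a (C.seq z x) = C.seq a (C.seq x z) := congrArg Subtype.val h1
    have h2' : C.seq a (C.seq z y) = C.seq a (C.seq y z) := congrArg Subtype.val h2
    rw [C.seq_seq_of_mem_range hac has z.2] at h1' h2'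
    rw [C.seq_seq_of_mem_range hac has x.2] at h1'
    rw [C.seq_seq_of_mem_range hac has y.2] at h2'
    exact Subtype.ext (congrArg (C.seq a)
      (C.comm_seq _ _ _ (hac z).symm (C.comm_oplus _ _ _ h1' h2' h)))
  smul_seq r x y h0 h1 := by
    refine Subtype.ext (congrArg (C.seq a) ?_)
    change C.seq (C.seq a _) y = C.smul r (C.seq a _)
    rw [C.seq_smul_of_mem_range has x.2 h0 h1, C.seq_seq_of_mem_range hac has x.2,
      C.smul_seq _ _ _ h0 h1]
  seq_smul r x y h0 h1 := by
    refine Subtype.ext (congrArg (C.seq a) ?_)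
    change C.seq x (C.seq a _) = C.smul r (C.seq a _)
    rw [C.seq_smul_of_mem_range has y.2 h0 h1, C.seq_seq_of_mem_range hac has x.2,
      C.seq_smul _ _ _ h0 h1]

/-- An element of the corner of a central sharp element is central as soon as it commutes with
the corner. -/
theorem comm_of_comm_range {a x : E} (hac : ∀ b, C.seq a b = C.seq b a) (has : C.IsSharp a)
    (hx : x ∈ Set.range (C.seq a))
    (h : ∀ y ∈ Set.range (C.seq a), C.seq x y = C.seq y x) (b : E) :
    C.seq x b = C.seq b x := by
  have hxa : C.seq x a = x := by rw [← hac, C.seq_of_mem_range has hx]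
  obtain ⟨hp, he⟩ := C.seq_oplus_seq_compl b a
  have hcompl : C.seq x (C.seq b (C.compl a)) = C.zero := by
    have hb : C.seq (C.compl a) b = C.seq b (C.compl a) :=
      (C.comm_compl _ _ (hac b).symm).symm
    rw [← hb, C.comm_assoc _ _ _ (C.comm_compl _ _ (hac x).symm),
      C.seq_compl_eq_zero hxa, C.zero_seq]
  rw [← he]
  refine C.comm_oplus _ _ _ (h _ ⟨b, hac b⟩) ?_ hp
  exact (C.seq_eq_zero_comm _ _ hcompl).symm

end COSEA

/-- for a minimal sharp central element `a`, the set
`F = {a∘b : b ∈ E}` is closed under `∘`, carries a COSEA structure with the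
indicated operations, and is a factor. -/
theorem central_minimal_sharp_factor {E : Type u} (C : COSEA E)
    (hFD : C.FinDim) (hSp : C.Spectral) (a : E) (ha : C.MinSharp C.center a) :
    (∀ x ∈ Set.range (C.seq a), ∀ y ∈ Set.range (C.seq a),
      C.seq x y ∈ Set.range (C.seq a)) ∧
    (∃ D : COSEA {x : E // x ∈ Set.range (C.seq a)},
      (D.zero : E) = C.zero ∧ (D.one : E) = a ∧
      (∀ b : E, (D.compl ⟨C.seq a b, ⟨b, rfl⟩⟩ : E) = C.seq a (C.compl b)) ∧
      (∀ b1 b2 : E, C.perp b1 b2 →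
        D.perp ⟨C.seq a b1, ⟨b1, rfl⟩⟩ ⟨C.seq a b2, ⟨b2, rfl⟩⟩ ∧
        (D.oplus ⟨C.seq a b1, ⟨b1, rfl⟩⟩ ⟨C.seq a b2, ⟨b2, rfl⟩⟩ : E) =
          C.seq a (C.oplus b1 b2)) ∧
      (∀ lam : ℝ, 0 ≤ lam → lam ≤ 1 → ∀ b : E,
        (D.smul lam ⟨C.seq a b, ⟨b, rfl⟩⟩ : E) = C.seq a (C.smul lam b)) ∧
      (∀ b c : E,
        (D.seq ⟨C.seq a b, ⟨b, rfl⟩⟩ ⟨C.seq a c, ⟨c, rfl⟩⟩ : E) =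
          C.seq a (C.seq b c))) ∧
    (∀ x ∈ Set.range (C.seq a),
      (∀ y ∈ Set.range (C.seq a), C.seq x y = C.seq y x) →
      ∃ lam : ℝ, 0 ≤ lam ∧ lam ≤ 1 ∧ x = C.smul lam a) := by
  obtain ⟨hac', has, -, -⟩ := id ha
  have hac := C.mem_center.1 hac'
  refine ⟨?_, ⟨C.corner hac has, C.seq_zero a, C.seq_one a, ?_, ?_, ?_, ?_⟩, ?_⟩
  · rintro x hx y -
    exact ⟨_, C.seq_seq_of_mem_range hac has hx y⟩
  · exact fun b => C.seq_compl_seq has b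
  · intro b1 b2 h
    have hp := C.seq_perp a _ _ h
    refine ⟨hp, ?_⟩
    change C.seq a (C.oplus (C.seq a b1) (C.seq a b2)) = _
    rw [C.seq_oplus_of_mem_range has ⟨b1, rfl⟩ ⟨b2, rfl⟩ hp, C.seq_oplus _ _ _ h]
  · intro r h0 h1 b
    change C.seq a (C.smul r (C.seq a b)) = _
    rw [C.seq_smul_of_mem_range has ⟨b, rfl⟩ h0 h1, C.seq_smul _ _ _ h0 h1]
  · intro b c
    change C.seq a (C.seq (C.seq a b) (C.seq a c)) = _
    rw [C.seq_seq_of_mem_range hac has ⟨b, rfl⟩, C.seq_seq_seq hac has]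
  · intro x hx h
    exact ha.eq_smul_of_mem_center hSp (C.comm_of_comm_range hac has hx h)
      (C.seq_of_mem_range has hx)
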